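/- (Theorem 2, second bullet, matrix form.) Let M ≥ 1 be an integer, Ũ ∈ ℂ^{M×M} with ŨᴴŨ = I_M, W₁, W₂ ∈ ℂ^{M×M} unitary, and α ∈ (0, π/2). Define G_i = [cos(α)·Ũ ; sin(α)·W_i] ∈ ℂ^{2M×M} and Γ = G₁ᴴG₂ = cos²(α)·I_M + sin²(α)·W₁ᴴW₂. Then {x ∈ ℂ^M : ΓᴴΓ·x = x} = {x ∈ ℂ^M : W₁ᴴW₂·x = x} as subspaces of ℂ^M. In particular, the number of singular values of Γ equal to 1 (i.e., the number of zero principal angles between span(G₁) and span(G₂)) equals the multiplicity of the eigenvalue 1 of W₁ᴴW₂. -/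

import Mathlib

open Matrix

/-- Theorem 2, second bullet, matrix form: for `α ∈ (0, π/2)`,
with `G_i = [cos(α)·Ũ ; sin(α)·W_i]` and `Γ = G₁ᴴ G₂`, one has
`Γ = cos²(α)·I + sin²(α)·W₁ᴴW₂`, and the fixed space of `Γᴴ Γ` equals the fixed
space of `W₁ᴴ W₂` (so the number of singular values of `Γ` equal to `1`, i.e. the
number of zero principal angles, equals the multiplicity of the eigenvalue `1`
of `W₁ᴴ W₂`). -/
theorem stmt_10 (M : ℕ) (hM : 1 ≤ M)
    (U W₁ W₂ : Matrix (Fin M) (Fin M) ℂ)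
    (hU : Uᴴ * U = 1)
    (hW₁ : W₁ᴴ * W₁ = 1) (hW₁' : W₁ * W₁ᴴ = 1)
    (hW₂ : W₂ᴴ * W₂ = 1) (hW₂' : W₂ * W₂ᴴ = 1)
    (α : ℝ) (hα : α ∈ Set.Ioo (0 : ℝ) (Real.pi / 2))
    (G₁ G₂ : Matrix (Fin M ⊕ Fin M) (Fin M) ℂ)
    (hG₁ : G₁ = Matrix.fromRows
      (((Real.cos α : ℝ) : ℂ) • U) (((Real.sin α : ℝ) : ℂ) • W₁))
    (hG₂ : G₂ = Matrix.fromRows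
      (((Real.cos α : ℝ) : ℂ) • U) (((Real.sin α : ℝ) : ℂ) • W₂))
    (Γ : Matrix (Fin M) (Fin M) ℂ)
    (hΓ : Γ = G₁ᴴ * G₂) :
    Γ = (((Real.cos α ^ 2 : ℝ)) : ℂ) • 1 + (((Real.sin α ^ 2 : ℝ)) : ℂ) • (W₁ᴴ * W₂) ∧
    {x : Fin M → ℂ | (Γᴴ * Γ) *ᵥ x = x} = {x : Fin M → ℂ | (W₁ᴴ * W₂) *ᵥ x = x} := by
  have hΓ' : Γ = (((Real.cos α ^ 2 : ℝ)) : ℂ) • 1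
      + (((Real.sin α ^ 2 : ℝ)) : ℂ) • (W₁ᴴ * W₂) := by
    rw [hΓ, hG₁, hG₂, Matrix.conjTranspose_fromRows_eq_fromCols_conjTranspose,
      Matrix.fromCols_mul_fromRows]
    simp only [Matrix.conjTranspose_smul, Matrix.smul_mul, Matrix.mul_smul, hU, smul_smul,
      Complex.star_def, Complex.conj_ofReal, ← sq, Complex.ofReal_pow]
  refine ⟨hΓ', ?_⟩
  have hs : 0 < Real.sin α := Real.sin_pos_of_pos_of_lt_pi hα.1 (by linarith [hα.2, Real.pi_pos])
  have hc : 0 < Real.cos α := Real.cos_pos_of_mem_Ioo ⟨by linarith [hα.1, Real.pi_pos], hα.2⟩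
  have hcs : Real.cos α ^ 2 = 1 - Real.sin α ^ 2 := by linarith [Real.sin_sq_add_cos_sq α]
  have hV : (W₁ᴴ * W₂)ᴴ * (W₁ᴴ * W₂) = 1 := by
    rw [Matrix.conjTranspose_mul, Matrix.conjTranspose_conjTranspose, Matrix.mul_assoc,
      ← Matrix.mul_assoc W₁, hW₁', Matrix.one_mul, hW₂]
  have hne : (((Real.cos α ^ 2 : ℝ)) : ℂ) * (((Real.sin α ^ 2 : ℝ)) : ℂ) ≠ 0 := by
    rw [← Complex.ofReal_mul]
    exact Complex.ofReal_ne_zero.mpr (by positivity)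
  have hcs' : (((Real.cos α ^ 2 : ℝ)) : ℂ) = 1 - (((Real.sin α ^ 2 : ℝ)) : ℂ) := by
    rw [hcs]; push_cast; rfl
  generalize W₁ᴴ * W₂ = V at *
  have key : 1 - Γᴴ * Γ = ((((Real.cos α ^ 2 : ℝ)) : ℂ) * (((Real.sin α ^ 2 : ℝ)) : ℂ)) •
      ((1 - V)ᴴ * (1 - V)) := by
    rw [hΓ']
    simp only [Matrix.conjTranspose_add, Matrix.conjTranspose_sub, Matrix.conjTranspose_smul,
      Matrix.conjTranspose_one, Complex.star_def, Complex.conj_ofReal, Matrix.add_mul,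
      Matrix.mul_add, Matrix.sub_mul, Matrix.mul_sub, Matrix.smul_mul, Matrix.mul_smul,
      Matrix.one_mul, Matrix.mul_one, hV]
    rw [hcs']
    module
  ext x
  simp only [Set.mem_ofPred_eq]
  have h1 : (Γᴴ * Γ) *ᵥ x = x ↔ (1 - Γᴴ * Γ) *ᵥ x = 0 := by
    rw [Matrix.sub_mulVec, Matrix.one_mulVec, sub_eq_zero, eq_comm]
  have h2 : V *ᵥ x = x ↔ (1 - V) *ᵥ x = 0 := by
    rw [Matrix.sub_mulVec, Matrix.one_mulVec, sub_eq_zero, eq_comm]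
  open scoped ComplexOrder in
  rw [h1, h2, key, Matrix.smul_mulVec, smul_eq_zero_iff_right hne,
    Matrix.conjTranspose_mul_self_mulVec_eq_zero]
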